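/- Let G be a countable discrete infinite amenable group acting continuously on a compact metric space (X,d), and let {F_n} be a tempered Følner sequence in G satisfying lim_{n→∞} |F_n|/log n = ∞. Then the Bowen topological entropy of the whole space X along {F_n} equals the topological entropy of the system: h^B_top(X,{F_n}) = h_top(X,G). -/

import Mathlib

open MeasureTheory Filter Set
open scoped Pointwise ENNReal NNReal Topology

section Defs

variable {G : Type*} [Group G] [DecidableEq G] {X : Type*}

/-- A Følner sequence: a sequence of nonempty finite subsets of `G` that is asymptotically
invariant: `|Fₙ △ gFₙ|/|Fₙ| → 0` for every `g ∈ G`. -/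
def IsFolnerSeq (F : ℕ → Finset G) : Prop :=
  (∀ n, (F n).Nonempty) ∧
    ∀ g : G, Tendsto (fun n => ((symmDiff (F n) ((F n).image (g * ·))).card : ℝ) / (F n).card)
      atTop (𝓝 0)

/-- A sequence of finite subsets is tempered if `|⋃_{k<n} Fₖ⁻¹ Fₙ| ≤ C |Fₙ|` for a constant `C`. -/
def IsTemperedSeq (F : ℕ → Finset G) : Prop :=
  ∃ C : ℝ, ∀ n : ℕ, (((Finset.range n).biUnion fun k => (F k)⁻¹ * F n).card : ℝ) ≤ C * (F n).card

/-- The growth condition `|Fₙ|/log n → ∞`. -/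
def GrowthCond (F : ℕ → Finset G) : Prop :=
  Tendsto (fun n => ((F n).card : ℝ) / Real.log n) atTop atTop

variable [MetricSpace X] [MulAction G X]

/-- The Bowen ball `B_F(x,ε) = {y : d(gx, gy) < ε for all g ∈ F}`. -/
def bowenBall (F : Finset G) (x : X) (ε : ℝ) : Set X :=
  {y | ∀ g ∈ F, dist (g • x) (g • y) < ε}

/-- `M(Z,N,ε,s,{Fₙ})`: infimum of `Σᵢ exp(-s |F_{nᵢ}|)` over countable families of Bowen balls
`B_{F_{nᵢ}}(xᵢ,ε)` with `nᵢ ≥ N` covering `Z`. -/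
noncomputable def bowenMpre (F : ℕ → Finset G) (Z : Set X) (N : ℕ) (ε s : ℝ) : ℝ≥0∞ :=
  ⨅ (C : Set (X × ℕ)) (_ : C.Countable ∧ (∀ p ∈ C, N ≤ p.2) ∧
      Z ⊆ ⋃ p ∈ C, bowenBall (F p.2) p.1 ε),
    ∑' p : C, ENNReal.ofReal (Real.exp (-s * ((F (p : X × ℕ).2).card : ℝ)))

/-- `M(Z,s,{Fₙ}) = lim_{ε→0} lim_{N→∞} M(Z,N,ε,s,{Fₙ})`; since the quantity is monotone
(nondecreasing as `N` increases and as `ε` decreases), the limits are suprema. -/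
noncomputable def bowenMeasure (F : ℕ → Finset G) (Z : Set X) (s : ℝ) : ℝ≥0∞ :=
  ⨆ (ε : ℝ) (_ : 0 < ε), ⨆ N : ℕ, bowenMpre F Z N ε s

/-- The Bowen topological entropy of `Z` along `{Fₙ}`: the critical value of `s` at which
`M(Z,s,{Fₙ})` jumps from `+∞` to `0`. -/
noncomputable def bowenEntropy (F : ℕ → Finset G) (Z : Set X) : ℝ≥0∞ :=
  ⨆ (s : ℝ) (_ : bowenMeasure F Z s = ⊤), ENNReal.ofReal s

/-- The minimal cardinality of a subcover of `⋁_{g ∈ F} g⁻¹ U` for a cover `U`. -/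
noncomputable def coverNumber (U : Finset (Set X)) (F : Finset G) : ℕ :=
  sInf {k : ℕ | ∃ f : Fin k → G → Set X, (∀ i, ∀ g ∈ F, f i g ∈ U) ∧
    (univ : Set X) ⊆ ⋃ i, ⋂ g ∈ F, (fun x => g • x) ⁻¹' f i g}

/-- The topological entropy of the `G`-action on `X` (computed along `{Fₙ}`; it is independent
of the Følner sequence). -/
noncomputable def topEntropy (X : Type*) [MetricSpace X] {G : Type*} [Group G] [MulAction G X]
    (F : ℕ → Finset G) : ℝ≥0∞ :=
  ⨆ (U : Finset (Set X)) (_ : (∀ V ∈ U, IsOpen V) ∧ ⋃₀ (U : Set (Set X)) = univ),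
    limsup (fun n => ENNReal.ofReal (Real.log (coverNumber U (F n)) / (F n).card)) atTop

end Defs

section MeasDefs

variable {G : Type*} [Group G] [DecidableEq G] {X : Type*} [MeasurableSpace X] [MulAction G X]

/-- The Shannon entropy `H_μ(⋁_{g∈F} g⁻¹ P)` of the join over `F` of the finite measurable
partition `P` given by the fibers of `α`. -/
noncomputable def partitionEntropy (μ : Measure X) {ι : Type*} [Fintype ι] (α : X → ι)
    (F : Finset G) : ℝ :=
  ∑ f : ↥F → ι, Real.negMulLog ((μ {x | ∀ g : ↥F, α ((g : G) • x) = f g}).toReal)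

/-- The entropy `h_μ(G,P) = lim_n H_μ(P^{Fₙ})/|Fₙ|` of the partition given by the fibers
of `α` (the limit existing, it is the `limsup`). -/
noncomputable def partitionDynEntropy (F : ℕ → Finset G) (μ : Measure X) {ι : Type*} [Fintype ι]
    (α : X → ι) : ℝ :=
  limsup (fun n => partitionEntropy μ α (F n) / (F n).card) atTop

/-- The measure-theoretic entropy `h_μ(X,G)`: the supremum over finite measurable partitions
(encoded as measurable maps `X → Fin k`) of `lim_n H_μ(P^{Fₙ})/|Fₙ|`. -/
noncomputable def measEntropy (F : ℕ → Finset G) (μ : Measure X) : ℝ≥0∞ :=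
  ⨆ (k : ℕ) (α : X → Fin k) (_ : Measurable α),
    limsup (fun n => ENNReal.ofReal (partitionEntropy μ α (F n) / (F n).card)) atTop

/-- `μ` is `G`-invariant. -/
def InvariantMeasure (G : Type*) [Group G] [MulAction G X] (μ : Measure X) : Prop :=
  ∀ g : G, Measure.map (fun x => g • x) μ = μ

/-- `μ` is ergodic: every Borel set `A` with `μ(A △ g⁻¹A) = 0` for all `g` is trivial. -/
def ErgodicMeasure (G : Type*) [Group G] [MulAction G X] (μ : Measure X) : Prop :=
  ∀ A : Set X, MeasurableSet A →
    (∀ g : G, μ (symmDiff A ((fun x => g • x) ⁻¹' A)) = 0) → μ A = 0 ∨ μ A = 1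

end MeasDefs

section LocalDefs

variable {G : Type*} [Group G] [DecidableEq G] {X : Type*} [MetricSpace X] [MulAction G X]
  [MeasurableSpace X]

/-- The set of generic points of `μ` with respect to `{Fₙ}`. -/
def genericPointSet (F : ℕ → Finset G) (μ : Measure X) : Set X :=
  {x | ∀ f : C(X, ℝ),
    Tendsto (fun n => (∑ g ∈ F n, f (g • x)) / (F n).card) atTop (𝓝 (∫ y, f y ∂μ))}

/-- The lower local entropy of `μ` at `x` along `{Fₙ}`:
`lim_{δ→0} liminf_n -(1/|Fₙ|) log μ(B_{Fₙ}(x,δ))` (the limit in `δ` being a supremum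
by monotonicity). -/
noncomputable def localLowerEntropy (F : ℕ → Finset G) (μ : Measure X) (x : X) : ℝ≥0∞ :=
  ⨆ (δ : ℝ) (_ : 0 < δ),
    liminf (fun n =>
      ENNReal.ofReal (-(Real.log ((μ (bowenBall (F n) x δ)).toReal)) / (F n).card)) atTop

end LocalDefs

section Aux

lemma aux_card_tile {G : Type*} [Group G] [DecidableEq G] (T : Finset G) (b : G) :
    (T.image (· * b)).card = T.card :=
  Finset.card_image_of_injective _ (mul_left_injective b)

lemma aux_single_level {G : Type*} [Group G] [DecidableEq G] (T A : Finset G) (hT : T.Nonempty)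
    (δ : ℝ) (hδ1 : δ ≤ 1) :
    ∃ S ⊆ A, (1 - δ) * ((S.card : ℝ) * T.card) ≤
        ((S.biUnion fun b => T.image (· * b)).card : ℝ) ∧
      δ * A.card ≤ ((S.biUnion fun b => T.image (· * b)).card : ℝ) := by
  classical
  let P : Finset (Finset G) := A.powerset.filter (fun S => (1 - δ) * ((S.card : ℝ) * T.card) ≤
        ((S.biUnion fun b => T.image (· * b)).card : ℝ))
  have hP : P.Nonempty := ⟨∅, by simp [P]⟩
  obtain ⟨S, hSP, hmax⟩ := Finset.exists_max_image P Finset.card hP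
  have hSP' := Finset.mem_filter.1 hSP
  have hSA : S ⊆ A := Finset.mem_powerset.1 hSP'.1
  refine ⟨S, hSA, hSP'.2, ?_⟩
  set W := S.biUnion fun b => T.image (· * b) with hW
  have hTpos : (0 : ℝ) < T.card := by exact_mod_cast hT.card_pos
  have key : ∀ a ∈ A, δ * T.card ≤ ((T.image (· * a) ∩ W).card : ℝ) := by
    intro a ha
    by_cases haS : a ∈ S
    · have : T.image (· * a) ∩ W = T.image (· * a) := by
        apply Finset.inter_eq_left.2
        exact Finset.subset_biUnion_of_mem (fun b => T.image (· * b)) haS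
      rw [this, aux_card_tile]
      nlinarith
    · by_contra! hlt
      have hins : insert a S ∈ P := by
        refine Finset.mem_filter.2 ⟨Finset.mem_powerset.2 (Finset.insert_subset ha hSA), ?_⟩
        rw [Finset.biUnion_insert, Finset.card_insert_of_notMem haS]
        have h1 := Finset.card_union_add_card_inter (T.image (· * a)) W
        rw [aux_card_tile] at h1
        have h1' : ((T.image (· * a) ∪ W).card : ℝ) + ((T.image (· * a) ∩ W).card : ℝ)
          = T.card + W.card := by exact_mod_cast h1
        have h2 := hSP'.2
        push_cast
        nlinarith
      have := hmax _ hins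
      rw [Finset.card_insert_of_notMem haS] at this
      omega
  have h3 : ∑ a ∈ A, (T.image (· * a) ∩ W).card ≤ W.card * T.card := by
    have : ∀ a ∈ A, (T.image (· * a) ∩ W).card = (W.filter (fun w => w ∈ T.image (· * a))).card := by
      intro a _
      congr 1
      ext w
      simp [and_comm]
    rw [Finset.sum_congr rfl this]
    simp_rw [Finset.card_filter]
    rw [Finset.sum_comm]
    rw [← smul_eq_mul, ← Finset.sum_const]
    apply Finset.sum_le_sum
    intro w _
    rw [← Finset.card_filter]
    apply Finset.card_le_card_of_injOn (fun a => w * a⁻¹)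
    · intro a ha
      simp only [Finset.coe_filter, Finset.mem_image, Set.mem_ofPred_eq] at ha
      obtain ⟨_, t, ht, rfl⟩ := ha
      simpa using ht
    · intro a _ b _ h
      simpa using h
  have h4 : ∑ a ∈ A, δ * (T.card : ℝ) ≤ ∑ a ∈ A, ((T.image (· * a) ∩ W).card : ℝ) :=
    Finset.sum_le_sum key
  have h3' : ∑ a ∈ A, ((T.image (· * a) ∩ W).card : ℝ) ≤ W.card * T.card := by exact_mod_cast h3
  rw [Finset.sum_const, nsmul_eq_mul] at h4
  have h5 : (δ * A.card) * T.card ≤ W.card * (T.card : ℝ) := by linarith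
  exact le_of_mul_le_mul_right h5 hTpos

lemma aux_cover {G : Type*} [Group G] [DecidableEq G] (F : ℕ → Finset G)
    (hne : ∀ n, (F n).Nonempty) (C : ℝ)
    (hC : ∀ n : ℕ, (((Finset.range n).biUnion fun k => (F k)⁻¹ * F n).card : ℝ) ≤ C * (F n).card)
    (δ : ℝ) (hδ0 : 0 < δ) (hδ1 : δ < 1) (τ : G → ℕ) (M : ℕ) :
    ∀ A : Finset G, (∀ a ∈ A, τ a < M) →
    ∃ S ⊆ A, (1 - δ) * (∑ g ∈ S, ((F (τ g)).card : ℝ)) ≤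
        ((S.biUnion fun b => (F (τ b)).image (· * b)).card : ℝ) ∧
      (A.card : ℝ) ≤ (δ⁻¹ + C * (1 - δ)⁻¹) *
        ((S.biUnion fun b => (F (τ b)).image (· * b)).card : ℝ) := by
  classical
  induction M with
  | zero =>
    intro A hA
    have : A = ∅ := Finset.eq_empty_of_forall_notMem fun a ha => by simpa using hA a ha
    subst this
    exact ⟨∅, by simp, by simp, by simp⟩
  | succ m ih =>
    intro A hA
    have hC0 : 0 ≤ C := by
      have h := hC 0
      have h' : (0 : ℝ) < (F 0).card := by exact_mod_cast (hne 0).card_pos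
      by_contra! hneg
      simp only [Finset.range_zero, Finset.biUnion_empty, Finset.card_empty, Nat.cast_zero] at h
      nlinarith
    obtain ⟨S₁, hS₁A, hS₁d, hS₁c⟩ := aux_single_level (F m) (A.filter (fun a => τ a = m)) (hne m) δ
      hδ1.le
    have hτ₁ : ∀ a ∈ S₁, τ a = m := fun a ha => (Finset.mem_filter.1 (hS₁A ha)).2
    set W₁ := S₁.biUnion fun b => (F m).image (· * b) with hW₁
    have hW₁' : (S₁.biUnion fun b => (F (τ b)).image (· * b)) = W₁ := by
      apply Finset.biUnion_congr rfl
      intro a ha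
      rw [hτ₁ a ha]
    let A' := A.filter (fun a => τ a < m ∧ Disjoint ((F (τ a)).image (· * a)) W₁)
    let R := A.filter (fun a => τ a < m ∧ ¬ Disjoint ((F (τ a)).image (· * a)) W₁)
    obtain ⟨S₂, hS₂A, hS₂d, hS₂c⟩ := ih A' (fun a ha => (Finset.mem_filter.1 ha).2.1)
    set W₂ := S₂.biUnion fun b => (F (τ b)).image (· * b) with hW₂
    have hdisj : Disjoint W₁ W₂ := by
      rw [hW₂, Finset.disjoint_biUnion_right]
      intro a ha
      exact ((Finset.mem_filter.1 (hS₂A ha)).2.2).symm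
    have hSd : Disjoint S₁ S₂ := by
      rw [Finset.disjoint_left]
      intro a h1 h2
      have := hτ₁ a h1
      have := (Finset.mem_filter.1 (hS₂A h2)).2.1
      omega
    have hU : ((S₁ ∪ S₂).biUnion fun b => (F (τ b)).image (· * b)) = W₁ ∪ W₂ := by
      rw [Finset.union_biUnion, hW₁']
    have hR : (R.card : ℝ) ≤ C * (S₁.card * (F m).card) := by
      have hsub : R ⊆ S₁.biUnion fun b =>
          ((Finset.range m).biUnion fun k => (F k)⁻¹ * F m).image (· * b) := by
        intro a ha
        obtain ⟨_, ham, hnd⟩ := Finset.mem_filter.1 ha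
        obtain ⟨w, hw1, hw2⟩ := Finset.not_disjoint_iff.1 hnd
        obtain ⟨t, ht, rfl⟩ := Finset.mem_image.1 hw1
        obtain ⟨b, hb, hw3⟩ := Finset.mem_biUnion.1 hw2
        obtain ⟨u, hu, hut⟩ := Finset.mem_image.1 hw3
        refine Finset.mem_biUnion.2 ⟨b, hb, Finset.mem_image.2 ⟨t⁻¹ * u, ?_, ?_⟩⟩
        · exact Finset.mem_biUnion.2 ⟨τ a, Finset.mem_range.2 ham,
            Finset.mul_mem_mul (Finset.inv_mem_inv ht) hu⟩
        · simp only [mul_assoc, hut]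
          group
      have h1 : R.card ≤ ∑ b ∈ S₁, ((Finset.range m).biUnion fun k => (F k)⁻¹ * F m).card := by
        refine (Finset.card_le_card hsub).trans (Finset.card_biUnion_le.trans ?_)
        apply Finset.sum_le_sum
        intro b _
        rw [aux_card_tile]
      rw [Finset.sum_const, smul_eq_mul] at h1
      have h2 : (R.card : ℝ) ≤ S₁.card *
        (((Finset.range m).biUnion fun k => (F k)⁻¹ * F m).card : ℝ) := by exact_mod_cast h1
      have h3 := mul_le_mul_of_nonneg_left (hC m) (Nat.cast_nonneg (α := ℝ) S₁.card)
      linarith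
    refine ⟨S₁ ∪ S₂, Finset.union_subset (hS₁A.trans (Finset.filter_subset _ _))
      (hS₂A.trans (Finset.filter_subset _ _)), ?_, ?_⟩
    · rw [hU, Finset.card_union_of_disjoint hdisj, Finset.sum_union hSd]
      have : ∑ g ∈ S₁, ((F (τ g)).card : ℝ) = S₁.card * (F m).card := by
        rw [Finset.sum_congr rfl (fun g hg => by rw [hτ₁ g hg]), Finset.sum_const, nsmul_eq_mul]
      rw [this]
      push_cast
      linarith
    · rw [hU, Finset.card_union_of_disjoint hdisj]
      have hAsub : A ⊆ A.filter (fun a => τ a = m) ∪ (R ∪ A') := by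
        intro a ha
        have := hA a ha
        rcases Nat.lt_succ_iff_lt_or_eq.1 this with h | h
        · by_cases hd : Disjoint ((F (τ a)).image (· * a)) W₁
          · exact Finset.mem_union_right _ (Finset.mem_union_right _
              (Finset.mem_filter.2 ⟨ha, h, hd⟩))
          · exact Finset.mem_union_right _ (Finset.mem_union_left _
              (Finset.mem_filter.2 ⟨ha, h, hd⟩))
        · exact Finset.mem_union_left _ (Finset.mem_filter.2 ⟨ha, h⟩)
      have hc : A.card ≤ (A.filter (fun a => τ a = m)).card + (R.card + A'.card) :=
        (Finset.card_le_card hAsub).trans ((Finset.card_union_le _ _).trans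
          (Nat.add_le_add_left (Finset.card_union_le _ _) _))
      have hc' : (A.card : ℝ) ≤ (A.filter (fun a => τ a = m)).card + (R.card + A'.card) := by
        exact_mod_cast hc
      have e1 : ((A.filter (fun a => τ a = m)).card : ℝ) ≤ δ⁻¹ * W₁.card := by
        rw [inv_mul_eq_div, le_div_iff₀ hδ0]
        linarith
      have e2 : (S₁.card : ℝ) * (F m).card ≤ (1 - δ)⁻¹ * W₁.card := by
        rw [inv_mul_eq_div, le_div_iff₀ (by linarith)]
        linarith
      have e3 := mul_le_mul_of_nonneg_left e2 hC0
      push_cast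
      nlinarith

/-- Tile attached to a centre and a ball. -/
def auxTile {G X : Type*} [Group G] [DecidableEq G] (F : ℕ → Finset G) (q : G × (X × ℕ)) :
    Finset G := (F q.2.2).image (· * q.1)

lemma aux_inv {G : Type*} [Group G] [DecidableEq G] (F : ℕ → Finset G) (hFol : IsFolnerSeq F)
    (η : ℝ) (hη : 0 < η) (K : Finset G) :
    ∀ᶠ n in atTop, (((K⁻¹ * F n) \ F n).card : ℝ) ≤ η * (F n).card ∧
      (((F n).filter (fun g => ∃ k ∈ K, k * g ∉ F n)).card : ℝ) ≤ η * (F n).card := by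
  classical
  obtain ⟨hne, hF⟩ := hFol
  have h1 : ∀ K : Finset G, Tendsto (fun n => ∑ g ∈ K,
      ((symmDiff (F n) ((F n).image (g * ·))).card : ℝ) / (F n).card) atTop (𝓝 0) := by
    intro K
    have := tendsto_finsetSum K (fun g _ => hF g)
    simpa using this
  filter_upwards [(h1 K).eventually_lt_const hη, (h1 K⁻¹).eventually_lt_const hη] with n hn1 hn2
  have hpos : (0 : ℝ) < (F n).card := by exact_mod_cast (hne n).card_pos
  rw [← Finset.sum_div, div_lt_iff₀ hpos] at hn1 hn2
  constructor
  · refine le_trans ?_ hn2.le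
    have hsub : (K⁻¹ * F n) \ F n ⊆ K⁻¹.biUnion fun g => symmDiff (F n) ((F n).image (g * ·)) := by
      intro x hx
      obtain ⟨hx1, hx2⟩ := Finset.mem_sdiff.1 hx
      obtain ⟨g, hg, f, hf, rfl⟩ := Finset.mem_mul.1 hx1
      refine Finset.mem_biUnion.2 ⟨g, hg, ?_⟩
      rw [Finset.mem_symmDiff]
      exact Or.inr ⟨Finset.mem_image_of_mem _ hf, hx2⟩
    exact_mod_cast (Finset.card_le_card hsub).trans Finset.card_biUnion_le
  · refine le_trans ?_ hn1.le
    have hsub : (F n).filter (fun g => ∃ k ∈ K, k * g ∉ F n) ⊆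
        K.biUnion fun k => (F n).filter (fun g => k * g ∉ F n) := by
      intro x hx
      obtain ⟨hx1, k, hk, hx2⟩ := Finset.mem_filter.1 hx
      exact Finset.mem_biUnion.2 ⟨k, hk, Finset.mem_filter.2 ⟨hx1, hx2⟩⟩
    have h2 : ((F n).filter (fun g => ∃ k ∈ K, k * g ∉ F n)).card ≤
        ∑ g ∈ K, (symmDiff (F n) ((F n).image (g * ·))).card := by
      refine (Finset.card_le_card hsub).trans (Finset.card_biUnion_le.trans ?_)
      apply Finset.sum_le_sum
      intro k _
      apply Finset.card_le_card_of_injOn (fun g => k * g)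
      · intro g hg
        obtain ⟨hg1, hg2⟩ := Finset.mem_filter.1 hg
        simp only [Finset.mem_coe]
        rw [Finset.mem_symmDiff]
        exact Or.inr ⟨Finset.mem_image_of_mem _ hg1, hg2⟩
      · intro a _ b _ h
        simpa using h
    exact_mod_cast h2

lemma aux_levels {G : Type*} [Group G] [DecidableEq G] {X : Type*} [MetricSpace X] [MulAction G X]
    (F : ℕ → Finset G) (hFol : IsFolnerSeq F) (C : ℝ)
    (hC : ∀ n : ℕ, (((Finset.range n).biUnion fun k => (F k)⁻¹ * F n).card : ℝ) ≤ C * (F n).card)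
    (δ : ℝ) (hδ0 : 0 < δ) (hδ1 : δ < 1) (s ε : ℝ) (κ : ℝ)
    (hlev : ∀ N : ℕ, ∃ D : Finset (X × ℕ), (∀ p ∈ D, N ≤ p.2) ∧
      (∀ x : X, ∃ p ∈ D, x ∈ bowenBall (F p.2) p.1 ε) ∧
      ∑ p ∈ D, Real.exp (-s * ((F p.2).card : ℝ)) ≤ κ)
    (β c : ℝ) (hβ : 0 < β) (hΓ : 0 < δ⁻¹ + C * (1 - δ)⁻¹)
    (hc : c * (δ⁻¹ + C * (1 - δ)⁻¹) = β / 2) (r : ℕ) :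
    ∀ N : ℕ, ∃ D : Finset (X × ℕ), (∀ p ∈ D, N ≤ p.2) ∧
      ∑ p ∈ D, Real.exp (-s * ((F p.2).card : ℝ)) ≤ r * κ ∧
      ∀ᶠ n in atTop, ∀ x : X, ∃ S ⊆ F n ×ˢ D,
        (∀ q ∈ S, q.1 • x ∈ bowenBall (F q.2.2) q.2.1 ε) ∧
        (∀ q ∈ S, auxTile F q ⊆ F n) ∧
        (1 - δ) * (∑ q ∈ S, ((F q.2.2).card : ℝ)) ≤ ((S.biUnion (auxTile F)).card : ℝ) ∧
        (((F n \ S.biUnion (auxTile F)).card : ℝ) < β * (F n).card ∨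
          r * c * (F n).card ≤ ((S.biUnion (auxTile F)).card : ℝ)) := by
  classical
  induction r with
  | zero =>
    intro N
    refine ⟨∅, by simp, by simp, Eventually.of_forall fun n x => ⟨∅, by simp, by simp, by simp,
      by simp, Or.inr (by simp)⟩⟩
  | succ r ih =>
    intro N
    obtain ⟨D₀, hD₀N, hD₀cov, hD₀s⟩ := hlev N
    let K : Finset G := D₀.biUnion fun p => F p.2
    have h1δ : 0 < 1 - δ := by linarith
    have hinv : 0 < (1 - δ)⁻¹ := inv_pos.2 h1δ
    let η : ℝ := (β / 2) / (1 + (1 - δ)⁻¹)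
    have hη : 0 < η := by positivity
    have hηeq : η * (1 + (1 - δ)⁻¹) = β / 2 := by
      simp only [η]; field_simp
    have hev := aux_inv F hFol η hη K
    obtain ⟨N₁, hN₁⟩ := eventually_atTop.1 hev
    obtain ⟨D₁, hD₁N, hD₁s, hD₁⟩ := ih (max N N₁)
    obtain ⟨M, hM⟩ : ∃ M, ∀ p ∈ D₀, p.2 < M :=
      ⟨D₀.sup (fun p => p.2) + 1, fun p hp =>
        Nat.lt_succ_of_le (Finset.le_sup (f := fun p : X × ℕ => p.2) hp)⟩
    refine ⟨D₀ ∪ D₁, ?_, ?_, ?_⟩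
    · intro p hp
      rcases Finset.mem_union.1 hp with h | h
      · exact hD₀N p h
      · exact (le_max_left _ _).trans (hD₁N p h)
    · have h := Finset.sum_union_inter (s₁ := D₀) (s₂ := D₁)
        (f := fun p => Real.exp (-s * ((F p.2).card : ℝ)))
      have h2 : 0 ≤ ∑ p ∈ D₀ ∩ D₁, Real.exp (-s * ((F p.2).card : ℝ)) :=
        Finset.sum_nonneg fun _ _ => (Real.exp_pos _).le
      push_cast
      linarith
    · filter_upwards [hev, hD₁] with n hn hn1 x
      obtain ⟨S, hSsub, hSx, hStile, hSd, hSor⟩ := hn1 x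
      set W := S.biUnion (auxTile F) with hW
      have hWsub : W ⊆ F n := Finset.biUnion_subset.2 hStile
      rcases hSor with hlt | hge
      · refine ⟨S, hSsub.trans ?_, hSx, hStile, hSd, Or.inl hlt⟩
        exact Finset.product_subset_product_right Finset.subset_union_right
      by_cases hlt : ((F n \ W).card : ℝ) < β * (F n).card
      · refine ⟨S, hSsub.trans ?_, hSx, hStile, hSd, Or.inl hlt⟩
        exact Finset.product_subset_product_right Finset.subset_union_right
      push Not at hlt
      choose i hiD hix using fun g : G => hD₀cov (g • x)
      let A := (F n).filter (fun g => auxTile F (g, i g) ⊆ F n ∧ Disjoint (auxTile F (g, i g)) W)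
      let B₁ := (F n).filter (fun g => ∃ k ∈ K, k * g ∉ F n)
      let B₂ := S.biUnion fun q => ((K⁻¹ * F q.2.2) \ F q.2.2).image (· * q.1)
      have hK : ∀ g, F (i g).2 ⊆ K := fun g =>
        Finset.subset_biUnion_of_mem (fun p : X × ℕ => F p.2) (hiD g)
      have hsub : F n \ W ⊆ A ∪ (B₁ ∪ B₂) := by
        intro g hg
        obtain ⟨hgF, hgW⟩ := Finset.mem_sdiff.1 hg
        by_cases h1 : auxTile F (g, i g) ⊆ F n
        · by_cases h2 : Disjoint (auxTile F (g, i g)) W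
          · exact Finset.mem_union_left _ (Finset.mem_filter.2 ⟨hgF, h1, h2⟩)
          · refine Finset.mem_union_right _ (Finset.mem_union_right _ ?_)
            obtain ⟨w, hw1, hw2⟩ := Finset.not_disjoint_iff.1 h2
            obtain ⟨t, ht, rfl⟩ := Finset.mem_image.1 hw1
            obtain ⟨q, hq, hw3⟩ := Finset.mem_biUnion.1 hw2
            obtain ⟨u, hu, hut⟩ := Finset.mem_image.1 hw3
            simp only at hut ht
            have e : t⁻¹ * u * q.1 = g := by rw [mul_assoc, hut]; group
            refine Finset.mem_biUnion.2 ⟨q, hq, Finset.mem_image.2 ⟨t⁻¹ * u, ?_, e⟩⟩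
            refine Finset.mem_sdiff.2 ⟨Finset.mul_mem_mul (Finset.inv_mem_inv (hK g ht)) hu, ?_⟩
            intro hmem
            exact hgW (Finset.mem_biUnion.2 ⟨q, hq, Finset.mem_image.2 ⟨_, hmem, e⟩⟩)
        · refine Finset.mem_union_right _ (Finset.mem_union_left _ ?_)
          obtain ⟨w, hw1, hw2⟩ := Finset.not_subset.1 h1
          obtain ⟨t, ht, rfl⟩ := Finset.mem_image.1 hw1
          exact Finset.mem_filter.2 ⟨hgF, t, hK g ht, hw2⟩
      have hcard : ((F n \ W).card : ℝ) ≤ A.card + (B₁.card + B₂.card) := by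
        exact_mod_cast (Finset.card_le_card hsub).trans ((Finset.card_union_le _ _).trans
          (Nat.add_le_add_left (Finset.card_union_le _ _) _))
      have hWn : (W.card : ℝ) ≤ (F n).card := by exact_mod_cast Finset.card_le_card hWsub
      have hB₁ : (B₁.card : ℝ) ≤ η * (F n).card := hn.2
      have hsum : ∑ q ∈ S, ((F q.2.2).card : ℝ) ≤ (1 - δ)⁻¹ * (F n).card := by
        rw [inv_mul_eq_div, le_div_iff₀ h1δ]
        linarith
      have hB₂ : (B₂.card : ℝ) ≤ η * ((1 - δ)⁻¹ * (F n).card) := by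
        have h1 : (B₂.card : ℝ) ≤ ∑ q ∈ S, (((K⁻¹ * F q.2.2) \ F q.2.2).card : ℝ) := by
          have : B₂.card ≤ ∑ q ∈ S, ((K⁻¹ * F q.2.2) \ F q.2.2).card := by
            refine Finset.card_biUnion_le.trans (Finset.sum_le_sum fun q _ => ?_)
            rw [aux_card_tile]
          exact_mod_cast this
        have h2 : ∑ q ∈ S, (((K⁻¹ * F q.2.2) \ F q.2.2).card : ℝ) ≤
            ∑ q ∈ S, η * ((F q.2.2).card : ℝ) := by
          apply Finset.sum_le_sum
          intro q hq
          have hq' := (Finset.mem_product.1 (hSsub hq)).2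
          exact (hN₁ _ ((le_max_right _ _).trans (hD₁N _ hq'))).1
        rw [← Finset.mul_sum] at h2
        exact h1.trans (h2.trans (mul_le_mul_of_nonneg_left hsum hη.le))
      have hA : β / 2 * (F n).card ≤ A.card := by
        have : η * (F n).card + η * ((1 - δ)⁻¹ * (F n).card) = β / 2 * (F n).card := by
          rw [← hηeq]; ring
        linarith
      obtain ⟨S₀, hS₀A, hS₀d, hS₀c⟩ := aux_cover F hFol.1 C hC δ hδ0 hδ1 (fun g => (i g).2) M A
        (fun a _ => hM _ (hiD a))
      let S₀' : Finset (G × (X × ℕ)) := S₀.image (fun g => (g, i g))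
      have hW₀ : (S₀.biUnion fun b => (F (i b).2).image (· * b)) = S₀'.biUnion (auxTile F) := by
        simp only [S₀', Finset.image_biUnion]
        rfl
      rw [hW₀] at hS₀d hS₀c
      set W₀ := S₀'.biUnion (auxTile F) with hW₀def
      have hS₀' : ∀ q ∈ S₀', ∃ g ∈ A, q = (g, i g) := by
        intro q hq
        obtain ⟨g, hg, rfl⟩ := Finset.mem_image.1 hq
        exact ⟨g, hS₀A hg, rfl⟩
      have hdisj : Disjoint W₀ W := by
        rw [hW₀def, Finset.disjoint_biUnion_left]
        intro q hq
        obtain ⟨g, hg, rfl⟩ := hS₀' q hq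
        exact (Finset.mem_filter.1 hg).2.2
      have hU : (S₀' ∪ S).biUnion (auxTile F) = W₀ ∪ W := by
        rw [Finset.union_biUnion]
      refine ⟨S₀' ∪ S, ?_, ?_, ?_, ?_, Or.inr ?_⟩
      · refine Finset.union_subset ?_
          (hSsub.trans (Finset.product_subset_product_right Finset.subset_union_right))
        intro q hq
        obtain ⟨g, hg, rfl⟩ := hS₀' q hq
        exact Finset.mem_product.2 ⟨(Finset.mem_filter.1 hg).1, Finset.mem_union_left _ (hiD g)⟩
      · intro q hq
        rcases Finset.mem_union.1 hq with h | h
        · obtain ⟨g, hg, rfl⟩ := hS₀' q h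
          exact hix g
        · exact hSx q h
      · intro q hq
        rcases Finset.mem_union.1 hq with h | h
        · obtain ⟨g, hg, rfl⟩ := hS₀' q h
          exact (Finset.mem_filter.1 hg).2.1
        · exact hStile q h
      · rw [hU, Finset.card_union_of_disjoint hdisj]
        have h := Finset.sum_union_inter (s₁ := S₀') (s₂ := S)
          (f := fun q => ((F q.2.2).card : ℝ))
        have h2 : 0 ≤ ∑ q ∈ S₀' ∩ S, ((F q.2.2).card : ℝ) :=
          Finset.sum_nonneg fun _ _ => Nat.cast_nonneg _
        have h3 : ∑ q ∈ S₀', ((F q.2.2).card : ℝ) = ∑ g ∈ S₀, ((F (i g).2).card : ℝ) := by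
          simp only [S₀']
          rw [Finset.sum_image]
          intro a _ b _ hab
          exact (Prod.ext_iff.1 hab).1
        have h4 : ∑ q ∈ S₀' ∪ S, ((F q.2.2).card : ℝ) ≤
            ∑ g ∈ S₀, ((F (i g).2).card : ℝ) + ∑ q ∈ S, ((F q.2.2).card : ℝ) := by linarith
        have h5 := mul_le_mul_of_nonneg_left h4 h1δ.le
        push_cast
        linarith
      · rw [hU, Finset.card_union_of_disjoint hdisj]
        have h1 : c * (F n).card ≤ W₀.card := by
          have : (δ⁻¹ + C * (1 - δ)⁻¹) * (c * (F n).card) ≤ (δ⁻¹ + C * (1 - δ)⁻¹) * W₀.card := by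
            calc (δ⁻¹ + C * (1 - δ)⁻¹) * (c * (F n).card) = β / 2 * (F n).card := by
                  rw [← hc]; ring
              _ ≤ A.card := hA
              _ ≤ _ := hS₀c
          exact le_of_mul_le_mul_left this hΓ
        push_cast
        linarith

lemma aux_coverNumber_le {G : Type*} [Group G] {X : Type*} [MetricSpace X]
    [MulAction G X] (U : Finset (Set X)) (E : Finset G) {ι : Type*} [Fintype ι]
    (f : ι → G → Set X) (hf : ∀ i, ∀ g ∈ E, f i g ∈ U)
    (hcov : ∀ x : X, ∃ i, ∀ g ∈ E, g • x ∈ f i g) :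
    coverNumber U E ≤ Fintype.card ι := by
  apply Nat.sInf_le
  let e := Fintype.equivFin ι
  refine ⟨fun k => f (e.symm k), fun k g hg => hf _ g hg, ?_⟩
  intro x _
  obtain ⟨i, hi⟩ := hcov x
  refine mem_iUnion.2 ⟨e i, ?_⟩
  simp only [mem_iInter, mem_preimage, Equiv.symm_apply_apply]
  exact hi

/-- Counting bound. -/
lemma aux_count {G : Type*} [Group G] [DecidableEq G] {X : Type*} [MetricSpace X] [MulAction G X]
    (F : ℕ → Finset G) (U : Finset (Set X)) (hU : ⋃₀ (U : Set (Set X)) = univ) (ε : ℝ)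
    (hleb : ∀ y : X, ∃ V ∈ U, Metric.ball y ε ⊆ V) (s t κ β : ℝ) (hs : 0 ≤ s) (E : Finset G)
    (D : Finset (X × ℕ)) (hD : ∑ p ∈ D, Real.exp (-s * ((F p.2).card : ℝ)) ≤ κ)
    (hE : ∀ x : X, ∃ S ⊆ E ×ˢ D,
        (∀ q ∈ S, q.1 • x ∈ bowenBall (F q.2.2) q.2.1 ε) ∧
        s * (∑ q ∈ S, ((F q.2.2).card : ℝ)) ≤ t * E.card ∧
        ((E \ S.biUnion (auxTile F)).card : ℝ) ≤ β * E.card) :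
    (coverNumber U E : ℝ) ≤
      Real.exp ((t + κ + β * Real.log (U.card + 1)) * E.card) := by
  classical
  choose v hvU hv using hleb
  let P : Finset (Finset (G × (X × ℕ))) := (E ×ˢ D).powerset.filter (fun S =>
    s * (∑ q ∈ S, ((F q.2.2).card : ℝ)) ≤ t * E.card ∧
        ((E \ S.biUnion (auxTile F)).card : ℝ) ≤ β * E.card)
  let ι := Σ S : P, ({h // h ∈ E \ S.1.biUnion (auxTile F)} → {V // V ∈ U})
  let f : ι → G → Set X := fun i h =>
    if hh : h ∈ E \ i.1.1.biUnion (auxTile F) then (i.2 ⟨h, hh⟩).1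
    else if hq : ∃ q ∈ i.1.1, h ∈ auxTile F q then
      v ((h * hq.choose.1⁻¹) • hq.choose.2.1) else ∅
  have h1 : coverNumber U E ≤ Fintype.card ι := by
    apply aux_coverNumber_le U E f
    · intro i h hE
      simp only [f]
      split_ifs with h1 h2
      · exact (i.2 ⟨h, h1⟩).2
      · exact hvU _
      · exfalso
        apply h1
        refine Finset.mem_sdiff.2 ⟨hE, fun h3 => h2 ?_⟩
        exact Finset.mem_biUnion.1 h3
    · intro x
      obtain ⟨S, hS, hSx, hS1, hS2⟩ := hE x
      have hu : ∀ y : X, ∃ V ∈ U, y ∈ V := by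
        intro y
        have : y ∈ ⋃₀ (U : Set (Set X)) := by rw [hU]; trivial
        obtain ⟨V, hV, hy⟩ := this
        exact ⟨V, hV, hy⟩
      choose u huU hu using hu
      refine ⟨⟨⟨S, Finset.mem_filter.2 ⟨Finset.mem_powerset.2 hS, hS1, hS2⟩⟩,
        fun h => ⟨u (h.1 • x), huU _⟩⟩, ?_⟩
      intro h hhE
      simp only [f]
      split_ifs with h1 h2
      · exact hu _
      · obtain ⟨hq1, hq2⟩ := h2.choose_spec
        set q := h2.choose
        apply hv
        obtain ⟨w, hw, hwq⟩ := Finset.mem_image.1 hq2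
        have := hSx q hq1 w hw
        rw [smul_smul, hwq] at this
        rw [Metric.mem_ball, dist_comm]
        have e : h * q.1⁻¹ = w := by rw [← hwq]; group
        rw [e]
        exact this
      · exfalso
        apply h1
        refine Finset.mem_sdiff.2 ⟨hhE, fun h3 => h2 ?_⟩
        exact Finset.mem_biUnion.1 h3
  have h2 : (Fintype.card ι : ℝ) = ∑ S ∈ P, (U.card : ℝ) ^ (E \ S.biUnion (auxTile F)).card := by
    simp only [ι, Fintype.card_sigma, Fintype.card_fun, Fintype.card_coe]
    push_cast
    rw [Finset.sum_coe_sort P (fun S => (U.card : ℝ) ^ (E \ S.biUnion (auxTile F)).card)]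
  have hlog : 0 ≤ Real.log (U.card + 1) := Real.log_nonneg (by
    have : (0 : ℝ) ≤ U.card := Nat.cast_nonneg _
    linarith)
  have h3 : ∀ S ∈ P, (U.card : ℝ) ^ (E \ S.biUnion (auxTile F)).card ≤
      Real.exp ((t + β * Real.log (U.card + 1)) * E.card) *
        ∏ q ∈ S, Real.exp (-s * ((F q.2.2).card : ℝ)) := by
    intro S hS
    obtain ⟨_, hS1, hS2⟩ := Finset.mem_filter.1 hS
    rw [← Real.exp_sum, ← Finset.mul_sum, ← Real.exp_add]
    calc (U.card : ℝ) ^ (E \ S.biUnion (auxTile F)).card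
        ≤ ((U.card : ℝ) + 1) ^ (E \ S.biUnion (auxTile F)).card :=
          pow_le_pow_left₀ (Nat.cast_nonneg _) (by linarith) _
      _ = Real.exp ((E \ S.biUnion (auxTile F)).card * Real.log (U.card + 1)) := by
          rw [Real.exp_nat_mul, Real.exp_log (by positivity)]
      _ ≤ _ := by
          apply Real.exp_le_exp.2
          have := mul_le_mul_of_nonneg_right hS2 hlog
          linarith
  have h4 : ∑ S ∈ P, ∏ q ∈ S, Real.exp (-s * ((F q.2.2).card : ℝ)) ≤ Real.exp (κ * E.card) := by
    calc ∑ S ∈ P, ∏ q ∈ S, Real.exp (-s * ((F q.2.2).card : ℝ))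
        ≤ ∑ S ∈ (E ×ˢ D).powerset, ∏ q ∈ S, Real.exp (-s * ((F q.2.2).card : ℝ)) := by
          apply Finset.sum_le_sum_of_subset_of_nonneg (Finset.filter_subset _ _)
          intro S _ _
          exact Finset.prod_nonneg fun _ _ => (Real.exp_pos _).le
      _ = ∏ q ∈ E ×ˢ D, (1 + Real.exp (-s * ((F q.2.2).card : ℝ))) := by
          rw [Finset.prod_one_add]
      _ ≤ ∏ q ∈ E ×ˢ D, Real.exp (Real.exp (-s * ((F q.2.2).card : ℝ))) := by
          apply Finset.prod_le_prod
          · intro q _; positivity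
          · intro q _
            rw [add_comm]
            exact Real.add_one_le_exp _
      _ = Real.exp (∑ q ∈ E ×ˢ D, Real.exp (-s * ((F q.2.2).card : ℝ))) := by
          rw [Real.exp_sum]
      _ ≤ _ := by
          apply Real.exp_le_exp.2
          rw [Finset.sum_product]
          simp only
          rw [Finset.sum_const, nsmul_eq_mul, mul_comm]
          exact mul_le_mul_of_nonneg_right hD (Nat.cast_nonneg _)
  calc (coverNumber U E : ℝ) ≤ Fintype.card ι := by exact_mod_cast h1
    _ = _ := h2
    _ ≤ ∑ S ∈ P, Real.exp ((t + β * Real.log (U.card + 1)) * E.card) *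
        ∏ q ∈ S, Real.exp (-s * ((F q.2.2).card : ℝ)) := Finset.sum_le_sum h3
    _ = Real.exp ((t + β * Real.log (U.card + 1)) * E.card) * ∑ S ∈ P,
        ∏ q ∈ S, Real.exp (-s * ((F q.2.2).card : ℝ)) := by rw [Finset.mul_sum]
    _ ≤ Real.exp ((t + β * Real.log (U.card + 1)) * E.card) * Real.exp (κ * E.card) :=
        mul_le_mul_of_nonneg_left h4 (Real.exp_pos _).le
    _ = _ := by
        rw [← Real.exp_add]
        congr 1
        ring

lemma aux_card_tendsto {G : Type*} [Group G] [DecidableEq G] (F : ℕ → Finset G)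
    (hGrow : GrowthCond F) : Tendsto (fun n => ((F n).card : ℝ)) atTop atTop := by
  have hlog : Tendsto (fun n : ℕ => Real.log n) atTop atTop :=
    Real.tendsto_log_atTop.comp tendsto_natCast_atTop_atTop
  refine tendsto_atTop_mono' atTop ?_ hlog
  filter_upwards [hGrow.eventually_ge_atTop 1, hlog.eventually_gt_atTop 0] with n h1 h2
  rw [le_div_iff₀ h2] at h1
  linarith

lemma aux_isOpen_bowenBall {G : Type*} [Group G] {X : Type*} [MetricSpace X] [MulAction G X]
    [ContinuousConstSMul G X] (F : Finset G) (x : X) (ε : ℝ) : IsOpen (bowenBall F x ε) := by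
  have : bowenBall F x ε = ⋂ g ∈ F, {y | dist (g • x) (g • y) < ε} := by
    ext y; simp [bowenBall]
  rw [this]
  apply isOpen_biInter_finset
  intro g _
  exact isOpen_lt (by fun_prop) continuous_const

lemma aux_level_exists {G : Type*} [Group G] [DecidableEq G] {X : Type*} [MetricSpace X]
    [CompactSpace X] [MulAction G X] [ContinuousConstSMul G X]
    (F : ℕ → Finset G) (hcard : Tendsto (fun n => ((F n).card : ℝ)) atTop atTop)
    (s s' : ℝ) (hss : s < s') (hM : bowenMeasure F (univ : Set X) s ≠ ⊤)
    (ε : ℝ) (hε : 0 < ε) (κ : ℝ) (hκ : 0 < κ) (N : ℕ) :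
    ∃ D : Finset (X × ℕ), (∀ p ∈ D, N ≤ p.2) ∧
      (∀ x : X, ∃ p ∈ D, x ∈ bowenBall (F p.2) p.1 ε) ∧
      ∑ p ∈ D, Real.exp (-s' * ((F p.2).card : ℝ)) ≤ κ := by
  classical
  set B := (bowenMeasure F (univ : Set X) s).toReal + 1 with hB
  have hBpos : 0 < B := by positivity
  have hlim : Tendsto (fun n => Real.exp (-((s' - s) * ((F n).card : ℝ))) * B) atTop (𝓝 0) := by
    have : Tendsto (fun n => Real.exp (-((s' - s) * ((F n).card : ℝ)))) atTop (𝓝 0) :=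
      Real.tendsto_exp_neg_atTop_nhds_zero.comp (hcard.const_mul_atTop (by linarith))
    simpa using this.mul_const B
  obtain ⟨N', hN'⟩ := eventually_atTop.1 (hlim.eventually_lt_const hκ)
  have hlt : bowenMpre F (univ : Set X) (max N N') ε s < ENNReal.ofReal B := by
    have h1 : bowenMpre F (univ : Set X) (max N N') ε s ≤ bowenMeasure F (univ : Set X) s :=
      le_trans (le_iSup (fun n => bowenMpre F (univ : Set X) n ε s) (max N N'))
        (le_iSup₂ (f := fun (ε : ℝ) (_ : 0 < ε) => ⨆ N : ℕ, bowenMpre F (univ : Set X) N ε s) ε hε)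
    refine lt_of_le_of_lt h1 ?_
    rw [← ENNReal.ofReal_toReal hM]
    exact (ENNReal.ofReal_lt_ofReal_iff hBpos).2 (by rw [hB]; linarith)
  unfold bowenMpre at hlt
  simp only [iInf_lt_iff] at hlt
  obtain ⟨Cv, ⟨_, hCN, hCcov⟩, hCs⟩ := hlt
  obtain ⟨D', hD'cov⟩ := isCompact_univ.elim_finite_subcover
    (fun p : Cv => bowenBall (F p.1.2) p.1.1 ε) (fun p => aux_isOpen_bowenBall _ _ _)
    (by
      intro x hx
      obtain ⟨p, hp, hxp⟩ := mem_iUnion₂.1 (hCcov hx)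
      exact mem_iUnion.2 ⟨⟨p, hp⟩, hxp⟩)
  have hsum : ∑ p ∈ D', Real.exp (-s * ((F p.1.2).card : ℝ)) ≤ B := by
    have h1 := (ENNReal.sum_le_tsum (f := fun p : Cv =>
      ENNReal.ofReal (Real.exp (-s * ((F (p : X × ℕ).2).card : ℝ)))) D').trans hCs.le
    rw [← ENNReal.ofReal_sum_of_nonneg (fun _ _ => (Real.exp_pos _).le)] at h1
    exact (ENNReal.ofReal_le_ofReal_iff hBpos.le).1 h1
  refine ⟨D'.map (Function.Embedding.subtype _), ?_, ?_, ?_⟩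
  · intro p hp
    obtain ⟨q, _, rfl⟩ := Finset.mem_map.1 hp
    exact (le_max_left _ _).trans (hCN _ q.2)
  · intro x
    obtain ⟨q, hq, hx⟩ := mem_iUnion₂.1 (hD'cov (mem_univ x))
    exact ⟨q, Finset.mem_map.2 ⟨q, hq, rfl⟩, hx⟩
  · rw [Finset.sum_map]
    simp only [Function.Embedding.subtype_apply]
    have h2 : ∀ p ∈ D', Real.exp (-s' * ((F p.1.2).card : ℝ)) ≤
        (κ / B) * Real.exp (-s * ((F p.1.2).card : ℝ)) := by
      intro p _
      have h3 := (hN' p.1.2 ((le_max_right _ _).trans (hCN _ p.2))).le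
      rw [← le_div_iff₀ hBpos] at h3
      have h4 : Real.exp (-s' * ((F p.1.2).card : ℝ)) =
          Real.exp (-((s' - s) * ((F p.1.2).card : ℝ))) *
            Real.exp (-s * ((F p.1.2).card : ℝ)) := by
        rw [← Real.exp_add]; congr 1; ring
      rw [h4]
      exact mul_le_mul_of_nonneg_right h3 (Real.exp_pos _).le
    refine (Finset.sum_le_sum h2).trans ?_
    rw [← Finset.mul_sum]
    calc κ / B * _ ≤ κ / B * B := mul_le_mul_of_nonneg_left hsum (by positivity)
      _ = κ := by field_simp

lemma aux_lower {G : Type*} [Group G] [DecidableEq G] {X : Type*} [MetricSpace X]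
    [CompactSpace X] [MulAction G X] [ContinuousConstSMul G X]
    (F : ℕ → Finset G) (hFol : IsFolnerSeq F) (hTemp : IsTemperedSeq F) (hGrow : GrowthCond F) :
    topEntropy X F ≤ bowenEntropy F (Set.univ : Set X) := by
  classical
  obtain ⟨C, hC⟩ := hTemp
  have hcard := aux_card_tendsto F hGrow
  have hC0 : 0 ≤ C := by
    have h := hC 0
    have h' : (0 : ℝ) < (F 0).card := by exact_mod_cast (hFol.1 0).card_pos
    by_contra! hneg
    simp only [Finset.range_zero, Finset.biUnion_empty, Finset.card_empty, Nat.cast_zero] at h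
    nlinarith
  refine iSup₂_le fun U hU => ?_
  apply le_of_forall_gt
  intro c hc
  obtain ⟨t, ht0, ht1, ht2⟩ := ENNReal.lt_iff_exists_real_btwn.1 hc
  refine lt_of_le_of_lt ?_ ht2
  obtain ⟨s, hs0, hs1, hs2⟩ := ENNReal.lt_iff_exists_real_btwn.1 ht1
  have hs : 0 < s := ENNReal.ofReal_pos.1 (lt_of_le_of_lt (zero_le) hs1)
  have hst : s < t := (ENNReal.ofReal_lt_ofReal_iff_of_nonneg hs0).1 hs2
  have hM : bowenMeasure F (univ : Set X) s ≠ ⊤ := by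
    intro h
    have : ENNReal.ofReal s ≤ bowenEntropy F (univ : Set X) :=
      le_iSup₂ (f := fun (s : ℝ) (_ : bowenMeasure F (univ : Set X) s = ⊤) => ENNReal.ofReal s) s h
    exact absurd hs1 (not_lt.2 this)
  obtain ⟨ε, hε, hleb⟩ := lebesgue_number_lemma_of_metric_sUnion (c := (U : Set (Set X)))
    isCompact_univ (fun V hV => hU.1 V hV) (by rw [hU.2])
  set u := (t - s) / 4 with hu
  have hu0 : 0 < u := by rw [hu]; linarith
  set s' := s + u with hs'
  have hs'0 : 0 < s' := by linarith
  set δ := u / (s' + u) with hδ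
  have hδ0 : 0 < δ := by positivity
  have hδ1 : δ < 1 := by rw [hδ, div_lt_one (by positivity)]; linarith
  have h1δ : (s' + u) * (1 - δ) = s' := by rw [hδ]; field_simp; ring
  set b := Real.log ((U.card : ℝ) + 1) with hb
  have hb0 : 0 ≤ b := Real.log_nonneg (by
    have : (0 : ℝ) ≤ U.card := Nat.cast_nonneg _
    linarith)
  set β := u / (b + 1) with hβ
  have hβ0 : 0 < β := by positivity
  have hβb : β * b ≤ u := by
    rw [hβ, div_mul_eq_mul_div, div_le_iff₀ (by positivity)]
    nlinarith
  have h1δ' : 0 < 1 - δ := by linarith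
  have hΓ : 0 < δ⁻¹ + C * (1 - δ)⁻¹ := by positivity
  set Γ := δ⁻¹ + C * (1 - δ)⁻¹ with hΓdef
  set c₀ := β / 2 / Γ with hc₀
  have hc₀0 : 0 < c₀ := by positivity
  have hc₀Γ : c₀ * Γ = β / 2 := by rw [hc₀]; field_simp
  obtain ⟨L, hL⟩ := exists_nat_gt (1 / c₀)
  have hL0 : (0 : ℝ) < L := lt_trans (by positivity) hL
  have hLc : 1 < L * c₀ := by rwa [div_lt_iff₀ hc₀0] at hL
  obtain ⟨D, _, hDs, hD⟩ := aux_levels F hFol C hC δ hδ0 hδ1 s' ε (u / L)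
    (fun N => aux_level_exists F hcard s s' (by linarith) hM ε hε (u / L) (by positivity) N)
    β c₀ hβ0 hΓ hc₀Γ L 0
  rw [mul_div_cancel₀ u hL0.ne'] at hDs
  refine limsup_le_of_le (by isBoundedDefault) ?_
  filter_upwards [hD] with n hn
  apply ENNReal.ofReal_le_ofReal
  have hpos : (0 : ℝ) < (F n).card := by exact_mod_cast (hFol.1 n).card_pos
  have hcount := aux_count F U hU.2 ε (fun y => by
    obtain ⟨V, hV, h⟩ := hleb y (mem_univ y)
    exact ⟨V, hV, h⟩) s' (s' + u) u β hs'0.le (F n) D hDs (by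
    intro x
    obtain ⟨S, hS1, hS2, hS3, hS4, hS5⟩ := hn x
    have hW : (((S.biUnion (auxTile F)).card : ℕ) : ℝ) ≤ (F n).card := by
      exact_mod_cast Finset.card_le_card (Finset.biUnion_subset.2 hS3)
    refine ⟨S, hS1, hS2, ?_, ?_⟩
    · have h1 := mul_le_mul_of_nonneg_left (hS4.trans hW) (show 0 ≤ s' + u by linarith)
      rw [← mul_assoc, h1δ] at h1
      exact h1
    · rcases hS5 with h | h
      · exact h.le
      · nlinarith)
  rw [div_le_iff₀ hpos]
  have ht4 : t = s' + u + u + u + u - u := by rw [hs', hu]; ring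
  rcases Nat.eq_zero_or_pos (coverNumber U (F n)) with h0 | h0
  · rw [h0]
    rw [Nat.cast_zero, Real.log_zero]
    exact mul_nonneg ht0 hpos.le
  · have h1 := Real.log_le_log (by exact_mod_cast h0) hcount
    rw [Real.log_exp] at h1
    refine h1.trans (mul_le_mul_of_nonneg_right ?_ hpos.le)
    linarith

lemma aux_coverNumber_spec {G : Type*} [Group G] {X : Type*} [MetricSpace X]
    [MulAction G X] (U : Finset (Set X)) (hU : ⋃₀ (U : Set (Set X)) = univ) (E : Finset G) :
    ∃ f : Fin (coverNumber U E) → G → Set X, (∀ i, ∀ g ∈ E, f i g ∈ U) ∧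
    (univ : Set X) ⊆ ⋃ i, ⋂ g ∈ E, (fun x => g • x) ⁻¹' f i g := by
  classical
  have hne : {k : ℕ | ∃ f : Fin k → G → Set X, (∀ i, ∀ g ∈ E, f i g ∈ U) ∧
    (univ : Set X) ⊆ ⋃ i, ⋂ g ∈ E, (fun x => g • x) ⁻¹' f i g}.Nonempty := by
    let ι := {g // g ∈ E} → {V // V ∈ U}
    let e := Fintype.equivFin ι
    refine ⟨Fintype.card ι, fun k g => if hg : g ∈ E then (e.symm k ⟨g, hg⟩).1 else ∅, ?_, ?_⟩
    · intro k g hg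
      simp only [hg, dif_pos]
      exact (e.symm k ⟨g, hg⟩).2
    · intro x _
      have hu : ∀ y : X, ∃ V ∈ U, y ∈ V := by
        intro y
        have : y ∈ ⋃₀ (U : Set (Set X)) := by rw [hU]; trivial
        obtain ⟨V, hV, hy⟩ := this
        exact ⟨V, hV, hy⟩
      choose u huU hu using hu
      refine mem_iUnion.2 ⟨e (fun g => ⟨u (g.1 • x), huU _⟩), ?_⟩
      simp only [mem_iInter, mem_preimage, Equiv.symm_apply_apply]
      intro g hg
      simp only [hg, dif_pos]
      exact hu _
  exact Nat.sInf_mem hne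

lemma aux_upper {G : Type*} [Group G] [DecidableEq G] {X : Type*} [MetricSpace X]
    [CompactSpace X] [MulAction G X]
    (F : ℕ → Finset G) (hFol : IsFolnerSeq F) :
    bowenEntropy F (Set.univ : Set X) ≤ topEntropy X F := by
  classical
  refine iSup₂_le fun s hs => ?_
  by_contra! hlt
  have hs0 : 0 < s := ENNReal.ofReal_pos.1 (lt_of_le_of_lt (zero_le) hlt)
  have : bowenMeasure F (univ : Set X) s ≤ 1 := by
    refine iSup₂_le fun ε hε => iSup_le fun N => ?_
    obtain ⟨t, _, htfin, htcov⟩ := finite_cover_balls_of_compact (isCompact_univ (X := X))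
      (half_pos hε)
    let U : Finset (Set X) := htfin.toFinset.image (fun x => Metric.ball x (ε / 2))
    have hUo : ∀ V ∈ U, IsOpen V := by
      intro V hV
      obtain ⟨x, _, rfl⟩ := Finset.mem_image.1 hV
      exact Metric.isOpen_ball
    have hUc : ⋃₀ (U : Set (Set X)) = univ := by
      apply eq_univ_of_forall
      intro y
      obtain ⟨x, hx, hy⟩ := mem_iUnion₂.1 (htcov (mem_univ y))
      exact ⟨_, Finset.mem_coe.2 (Finset.mem_image.2 ⟨x, htfin.mem_toFinset.2 hx, rfl⟩), hy⟩
    have hUd : ∀ V ∈ U, ∀ x ∈ V, ∀ y ∈ V, dist x y < ε := by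
      intro V hV x hx y hy
      obtain ⟨z, _, rfl⟩ := Finset.mem_image.1 hV
      have h1 := Metric.mem_ball.1 hx
      have h2 := Metric.mem_ball'.1 hy
      have := dist_triangle x z y
      linarith
    have hl : limsup (fun n => ENNReal.ofReal (Real.log (coverNumber U (F n)) / (F n).card)) atTop
        < ENNReal.ofReal s :=
      lt_of_le_of_lt (le_iSup₂ (f := fun (U : Finset (Set X))
        (_ : (∀ V ∈ U, IsOpen V) ∧ ⋃₀ (U : Set (Set X)) = univ) =>
          limsup (fun n => ENNReal.ofReal (Real.log (coverNumber U (F n)) / (F n).card)) atTop)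
          U ⟨hUo, hUc⟩) hlt
    have hev := eventually_lt_of_limsup_lt hl
    obtain ⟨n, hn, hnN⟩ := (hev.and (eventually_ge_atTop N)).exists
    have hpos : (0 : ℝ) < (F n).card := by exact_mod_cast (hFol.1 n).card_pos
    have hlog : Real.log (coverNumber U (F n)) ≤ s * (F n).card := by
      have := (ENNReal.ofReal_lt_ofReal_iff hs0).1 hn
      rw [div_lt_iff₀ hpos] at this
      exact this.le
    have hk : (coverNumber U (F n) : ℝ) * Real.exp (-s * (F n).card) ≤ 1 := by
      rcases Nat.eq_zero_or_pos (coverNumber U (F n)) with h0 | h0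
      · rw [h0]; simp
      · rw [← Real.exp_log (show (0 : ℝ) < (coverNumber U (F n) : ℝ) by exact_mod_cast h0),
          ← Real.exp_add]
        apply Real.exp_le_one_iff.2
        linarith
    obtain ⟨f, hfU, hfc⟩ := aux_coverNumber_spec U hUc (F n)
    let I := {i : Fin (coverNumber U (F n)) // (⋂ g ∈ F n, (fun x : X => g • x) ⁻¹' f i g).Nonempty}
    let Cf : Finset (X × ℕ) := (Finset.univ : Finset I).image (fun i => (i.2.some, n))
    have hCf2 : ∀ p ∈ Cf, p.2 = n := by
      intro p hp
      obtain ⟨i, _, rfl⟩ := Finset.mem_image.1 hp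
      rfl
    have hCfc : Cf.card ≤ coverNumber U (F n) := by
      refine Finset.card_image_le.trans ?_
      rw [Finset.card_univ]
      refine (Fintype.card_subtype_le _).trans ?_
      simp
    refine (iInf₂_le (Cf : Set (X × ℕ)) (show _ ∧ _ ∧ _ from
      ⟨Cf.countable_toSet, ?_, ?_⟩)).trans ?_
    · intro p hp
      rw [hCf2 p hp]
      exact hnN
    · intro y hy
      obtain ⟨i, hi⟩ := mem_iUnion.1 (hfc hy)
      let i' : I := ⟨i, ⟨y, hi⟩⟩
      refine mem_iUnion₂.2 ⟨(i'.2.some, n), Finset.mem_coe.2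
        (Finset.mem_image.2 ⟨i', Finset.mem_univ _, rfl⟩), ?_⟩
      intro g hg
      have h1 := i'.2.some_mem
      simp only [mem_iInter, mem_preimage] at h1 hi
      exact hUd _ (hfU i g hg) _ (h1 g hg) _ (hi g hg)
    · have hts := Finset.tsum_subtype' Cf
        (fun p : X × ℕ => ENNReal.ofReal (Real.exp (-s * ((F p.2).card : ℝ))))
      refine hts.le.trans ?_
      rw [← ENNReal.ofReal_sum_of_nonneg (fun _ _ => (Real.exp_pos _).le)]
      rw [ENNReal.ofReal_le_one]
      rw [Finset.sum_congr rfl (fun p hp => by rw [hCf2 p hp]), Finset.sum_const, nsmul_eq_mul]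
      refine le_trans ?_ hk
      exact mul_le_mul_of_nonneg_right (by exact_mod_cast hCfc) (Real.exp_pos _).le
  rw [hs] at this
  exact absurd this (by simp)

end Aux

variable {G : Type*} [Group G] [Countable G] [Infinite G] [DecidableEq G]
  {X : Type*} [MetricSpace X] [CompactSpace X] [MulAction G X] [ContinuousConstSMul G X]
  [MeasurableSpace X] [BorelSpace X]

theorem bowenEntropy_univ_eq_topEntropy
    (F : ℕ → Finset G) (hFol : IsFolnerSeq F) (hTemp : IsTemperedSeq F) (hGrow : GrowthCond F) :
    bowenEntropy F (Set.univ : Set X) = topEntropy X F := by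
  exact le_antisymm (aux_upper F hFol) (aux_lower F hFol hTemp hGrow)
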